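/- Representation theorem for rational relations: a binary relation |~ on the formulas of a propositional language L is a rational consequence relation if and only if it is the consequence relation defined by some ranked model. Moreover, if L is logically finite (built over finitely many propositional variables), then every rational consequence relation is defined by some finite ranked model. -/

import Mathlib

/-- Propositional formulas over a set `V` of propositional variables. -/
inductive Fm (V : Type) : Type
  | var : V → Fm V
  | fls : Fm V
  | tru : Fm V
  | neg : Fm V → Fm V
  | conj : Fm V → Fm V → Fm V
  | disj : Fm V → Fm V → Fm V
  | impl : Fm V → Fm V → Fm V
  | iff : Fm V → Fm V → Fm V

variable {V : Type}

/-- Truth value of a formula in a world (truth assignment). -/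
def Fm.eval (w : V → Bool) : Fm V → Bool
  | .var v => w v
  | .fls => false
  | .tru => true
  | .neg a => !(a.eval w)
  | .conj a b => a.eval w && b.eval w
  | .disj a b => a.eval w || b.eval w
  | .impl a b => !(a.eval w) || b.eval w
  | .iff a b => a.eval w == b.eval w

/-- A formula is valid iff it is satisfied by every world. -/
def Valid (a : Fm V) : Prop := ∀ w : V → Bool, a.eval w = true

/-- A conditional "relation": a set of conditional assertions (pairs of formulas). -/
abbrev CRel (V : Type) := Set (Fm V × Fm V)

/-- Preferential consequence relation: Reflexivity, Left Logical Equivalence,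
Right Weakening, And, Or, Cautious Monotonicity. -/
def IsPreferential (K : CRel V) : Prop :=
  (∀ a, (a, a) ∈ K) ∧
  (∀ a b c, Valid (a.iff b) → (a, c) ∈ K → (b, c) ∈ K) ∧
  (∀ a b c, Valid (a.impl b) → (c, a) ∈ K → (c, b) ∈ K) ∧
  (∀ a b c, (a, b) ∈ K → (a, c) ∈ K → (a, b.conj c) ∈ K) ∧
  (∀ a b c, (a, c) ∈ K → (b, c) ∈ K → (a.disj b, c) ∈ K) ∧
  (∀ a b c, (a, b) ∈ K → (a, c) ∈ K → (a.conj b, c) ∈ K)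

/-- Rational Monotonicity: if α∧β |~/ γ and α |~/ ¬β then α |~/ γ. -/
def RationalMonotonicity (K : CRel V) : Prop :=
  ∀ a b c, (a.conj b, c) ∉ K → (a, b.neg) ∉ K → (a, c) ∉ K

/-- A rational consequence relation is a preferential one satisfying Rational
Monotonicity. -/
def IsRational (K : CRel V) : Prop := IsPreferential K ∧ RationalMonotonicity K

/-- Disjunctive Rationality: if α |~/ γ and β |~/ γ then α∨β |~/ γ. -/
def DisjunctiveRationality (K : CRel V) : Prop :=
  ∀ a b c, (a, c) ∉ K → (b, c) ∉ K → (a.disj b, c) ∉ K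

/-- Negation Rationality: if α∧γ |~/ β and α∧¬γ |~/ β then α |~/ β. -/
def NegationRationality (K : CRel V) : Prop :=
  ∀ a b c, (a.conj c, b) ∉ K → (a.conj c.neg, b) ∉ K → (a, b) ∉ K

/-- `s` is minimal in `A` with respect to the strict order `lt`. -/
def MinIn {S : Type} (lt : S → S → Prop) (A : Set S) (s : S) : Prop :=
  s ∈ A ∧ ∀ t ∈ A, ¬ lt t s

/-- A preferential model: states, labeling by worlds, a strict partial order
satisfying the smoothness condition for each formula. -/
structure PrefModel (V : Type) where
  S : Type
  l : S → V → Bool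
  lt : S → S → Prop
  irrefl : ∀ s, ¬ lt s s
  trans : ∀ s t u, lt s t → lt t u → lt s u
  smooth : ∀ (a : Fm V) (s : S), a.eval (l s) = true →
    MinIn lt {t | a.eval (l t) = true} s ∨
    ∃ t, MinIn lt {t | a.eval (l t) = true} t ∧ lt t s

/-- The model `W` satisfies α |~ β iff every state minimal in α̂ satisfies β. -/
def PrefModel.Sat (W : PrefModel V) (a b : Fm V) : Prop :=
  ∀ s, MinIn W.lt {t | a.eval (W.l t) = true} s → b.eval (W.l s) = true

/-- The consequence relation defined by a preferential model. -/
def PrefModel.Rel (W : PrefModel V) : CRel V := {p | W.Sat p.1 p.2}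

/-- `W` is a model of the knowledge base `K`. -/
def PrefModel.Models (W : PrefModel V) (K : CRel V) : Prop := ∀ p ∈ K, W.Sat p.1 p.2

/-- Preferential entailment: `A` is satisfied by every preferential model of `K`. -/
def Entails (K : CRel V) (A : Fm V × Fm V) : Prop :=
  ∀ W : PrefModel V, W.Models K → W.Sat A.1 A.2

/-- The preferential closure of a knowledge base. -/
def PrefClosure (K : CRel V) : CRel V := {A | Entails K A}

/-- A model is well-founded iff it has no infinite descending chain of states. -/
def PrefModel.NoInfDesc (W : PrefModel V) : Prop :=
  ¬ ∃ f : ℕ → W.S, ∀ n, W.lt (f (n + 1)) (f n)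

/-- A ranked model: the strict order is given by a ranking function into a
totally ordered set. -/
def PrefModel.Ranked (W : PrefModel V) : Prop :=
  ∃ (Ω : Type) (_ : LinearOrder Ω) (r : W.S → Ω), ∀ s t, W.lt s t ↔ r s < r t

/-- α is exceptional for K iff K preferentially entails true |~ ¬α. -/
def Exceptional (K : CRel V) (a : Fm V) : Prop := Entails K (Fm.tru, a.neg)

/-- The set of assertions of K whose antecedent is exceptional for K. -/
def ESet (K : CRel V) : CRel V := {p ∈ K | Exceptional K p.1}

/-- The exceptionality hierarchy: C₀ = K, C_{τ+1} = E(C_τ), intersections at limits. -/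
noncomputable def Cseq (K : CRel V) : Ordinal.{0} → CRel V := fun τ =>
  Ordinal.limitRecOn τ K (fun _ C => ESet C)
    (fun o _ ih => ⋂ ρ : Set.Iio o, ih ρ.1 ρ.2)

/-- α has a rank for K iff it is not exceptional for some C_τ. -/
def HasRank (K : CRel V) (a : Fm V) : Prop := ∃ τ : Ordinal.{0}, ¬ Exceptional (Cseq K τ) a

/-- The rank of α for K: the least τ such that α is not exceptional for C_τ. -/
noncomputable def rnk (K : CRel V) (a : Fm V) : Ordinal.{0} :=
  sInf {τ : Ordinal.{0} | ¬ Exceptional (Cseq K τ) a}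

/-- K is admissible iff every formula with no rank is inconsistent for K. -/
def Admissible (K : CRel V) : Prop :=
  ∀ a : Fm V, ¬ HasRank K a → Entails K (a, Fm.fls)

/-- `α < β in K`: the assertion α∨β |~ ¬β belongs to K. -/
def ltIn (K : CRel V) (a b : Fm V) : Prop := (a.disj b, b.neg) ∈ K

/-- K₀ is preferable to K₁. -/
def Pref (K0 K1 : CRel V) : Prop :=
  (∃ a b, (a, b) ∈ K1 \ K0 ∧
    ∀ c, ltIn K0 c a → ∀ d, (c, d) ∈ K0 → (c, d) ∈ K1) ∧
  (∀ c d, (c, d) ∈ K0 \ K1 → ∃ r e, (r, e) ∈ K1 \ K0 ∧ ltIn K1 r c)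

/-- C is the rational closure of K: a rational extension of K preferable to
every other rational extension of K. -/
def IsRationalClosure (K C : CRel V) : Prop :=
  IsRational C ∧ K ⊆ C ∧ ∀ C', IsRational C' → K ⊆ C' → C' ≠ C → Pref C C'

/-- An assertion α |~ β is supported by K^p iff there is γ with α ⊨ γ and
γ |~ β ∈ K^p. -/
def Supported (K : CRel V) (A : Fm V × Fm V) : Prop :=
  ∃ c : Fm V, Valid (A.1.impl c) ∧ (c, A.2) ∈ PrefClosure K

/-- Classical entailment from the material counterpart of a knowledge base. -/
def MatEntails (K : CRel V) (a : Fm V) : Prop :=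
  ∀ w : V → Bool, (∀ p ∈ K, (p.1.impl p.2).eval w = true) → a.eval w = true

theorem PrefModel.isPreferential_rel {V : Type} (W : PrefModel V) : IsPreferential W.Rel := by
  refine ⟨fun a s hs => hs.1, ?_, ?_, ?_, ?_, ?_⟩
  · intro a b c hab h s hs
    have hab' : ∀ w, a.eval w = b.eval w := fun w => by simpa [Fm.eval] using hab w
    refine h s ?_
    simpa only [hab'] using hs
  · intro a b c hab h s hs
    have h₁ := hab (W.l s)
    have h₂ : a.eval (W.l s) = true := h s hs
    simpa [Fm.eval, h₂] using h₁
  · intro a b c hb hc s hs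
    have h₁ : b.eval (W.l s) = true := hb s hs
    have h₂ : c.eval (W.l s) = true := hc s hs
    simp [Fm.eval, h₁, h₂]
  · intro a b c ha hb s ⟨hs, hmin⟩
    have hs' : a.eval (W.l s) = true ∨ b.eval (W.l s) = true := by simpa [Fm.eval] using hs
    rcases hs' with h | h
    · exact ha s ⟨h, fun t ht => hmin t (by simp_all [Fm.eval])⟩
    · exact hb s ⟨h, fun t ht => hmin t (by simp_all [Fm.eval])⟩
  · intro a b c hb hc s ⟨hs, hmin⟩
    have hs' : a.eval (W.l s) = true ∧ b.eval (W.l s) = true := by simpa [Fm.eval] using hs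
    rcases W.smooth a s hs'.1 with h | ⟨t, ht, hts⟩
    · exact hc s h
    · have htb : b.eval (W.l t) = true := hb t ht
      have hta : a.eval (W.l t) = true := ht.1
      exact absurd hts (hmin t (by simp [Fm.eval, hta, htb]))

theorem PrefModel.Ranked.isRational_rel {V : Type} {W : PrefModel V} (hW : W.Ranked) :
    IsRational W.Rel := by
  refine ⟨W.isPreferential_rel, fun a b c hab hb hac => ?_⟩
  obtain ⟨Ω, _, r, hr⟩ := hW
  refine hb fun s hs => ?_
  by_contra hsb
  have hsb : b.eval (W.l s) = true := by simpa [Fm.eval] using hsb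
  have hsa : a.eval (W.l s) = true := hs.1
  refine hab fun t ⟨ht, hmin⟩ => hac t ⟨?_, fun u hu hut => ?_⟩
  · have : a.eval (W.l t) = true ∧ b.eval (W.l t) = true := by simpa [Fm.eval] using ht
    exact this.1
  · have hst := hmin s (by simp [Fm.eval, hsa, hsb])
    have hus := hs.2 u hu
    rw [hr] at hut hst hus
    exact hus (hut.trans_le (not_lt.mp hst))

/-- The worlds that are normal for `a`: those satisfying every consequence of `a`. -/
def normalWorlds {V : Type} (K : CRel V) (a : Fm V) : Set (V → Bool) :=
  {w | ∀ b, (a, b) ∈ K → b.eval w = true}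

theorem Fm.continuous_eval {V : Type} (a : Fm V) : Continuous fun w : V → Bool => a.eval w := by
  induction a with
  | var v => exact continuous_apply v
  | fls => exact continuous_const
  | tru => exact continuous_const
  | neg a ha => exact (continuous_of_discreteTopology (f := Bool.not)).comp ha
  | conj a b ha hb =>
    exact (continuous_of_discreteTopology (f := fun p : Bool × Bool => p.1 && p.2)).comp
      (ha.prodMk hb)
  | disj a b ha hb =>
    exact (continuous_of_discreteTopology (f := fun p : Bool × Bool => p.1 || p.2)).comp
      (ha.prodMk hb)
  | impl a b ha hb =>
    exact (continuous_of_discreteTopology (f := fun p : Bool × Bool => !p.1 || p.2)).comp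
      (ha.prodMk hb)
  | iff a b ha hb =>
    exact (continuous_of_discreteTopology (f := fun p : Bool × Bool => p.1 == p.2)).comp
      (ha.prodMk hb)

theorem Fm.isClosed_models {V : Type} (a : Fm V) : IsClosed {w : V → Bool | a.eval w = true} :=
  isClosed_singleton.preimage a.continuous_eval

namespace IsPreferential

variable {V : Type} {K : CRel V}

theorem refl (hK : IsPreferential K) (a : Fm V) : (a, a) ∈ K := hK.1 a

theorem left_equiv (hK : IsPreferential K) {a b c : Fm V} (h : ∀ w, a.eval w = b.eval w)
    (hac : (a, c) ∈ K) : (b, c) ∈ K :=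
  hK.2.1 a b c (fun w => by simp [Fm.eval, h w]) hac

theorem right_weaken (hK : IsPreferential K) {a b c : Fm V}
    (h : ∀ w, b.eval w = true → c.eval w = true) (hab : (a, b) ∈ K) : (a, c) ∈ K :=
  hK.2.2.1 b c a (fun w => by cases hb : b.eval w <;> simp_all [Fm.eval]) hab

theorem and (hK : IsPreferential K) {a b c : Fm V} (hb : (a, b) ∈ K) (hc : (a, c) ∈ K) :
    (a, b.conj c) ∈ K := hK.2.2.2.1 a b c hb hc

theorem or (hK : IsPreferential K) {a b c : Fm V} (ha : (a, c) ∈ K) (hb : (b, c) ∈ K) :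
    (a.disj b, c) ∈ K := hK.2.2.2.2.1 a b c ha hb

theorem cautious_mono (hK : IsPreferential K) {a b c : Fm V} (hb : (a, b) ∈ K)
    (hc : (a, c) ∈ K) : (a.conj b, c) ∈ K := hK.2.2.2.2.2 a b c hb hc

theorem eval_of_mem_normalWorlds (hK : IsPreferential K) {a : Fm V} {w : V → Bool}
    (hw : w ∈ normalWorlds K a) : a.eval w = true := hw a (hK.refl a)

theorem mem_iff_normalWorlds (hK : IsPreferential K) {a b : Fm V} :
    (a, b) ∈ K ↔ ∀ w ∈ normalWorlds K a, b.eval w = true := by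
  refine ⟨fun h w hw => hw b h, fun h => ?_⟩
  have : Nonempty {c : Fm V // (a, c) ∈ K} := ⟨⟨a, hK.refl a⟩⟩
  obtain ⟨⟨c, hc⟩, hcb⟩ := IsCompact.elim_directed_family_closed
      (Fm.isClosed_models b.neg).isCompact
      (fun c : {c : Fm V // (a, c) ∈ K} => {w | c.1.eval w = true})
      (fun c => c.1.isClosed_models)
      (by
        ext w
        simp only [Set.mem_inter_iff, Set.mem_ofPred_eq, Set.mem_iInter, Set.mem_empty_iff_false,
          iff_false, not_and]
        intro hb hw
        have := h w fun c hc => hw ⟨c, hc⟩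
        simp [Fm.eval, this] at hb)
      (fun c d => ⟨⟨c.1.conj d.1, hK.and c.2 d.2⟩,
        fun w hw => by simp_all [Fm.eval], fun w hw => by simp_all [Fm.eval]⟩)
  refine hK.right_weaken (fun w hw => ?_) hc
  by_contra hb
  have : w ∈ ({w | b.neg.eval w = true} ∩ {w | c.eval w = true} : Set (V → Bool)) :=
    ⟨by simpa [Fm.eval] using hb, hw⟩
  rw [hcb] at this
  exact this

/-- If `b` entails `a`, then every normal `a`-world satisfying `b` is a normal `b`-world. -/
theorem mem_normalWorlds_of_entails (hK : IsPreferential K) {a b : Fm V}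
    (hba : ∀ w, b.eval w = true → a.eval w = true) {w : V → Bool}
    (hw : w ∈ normalWorlds K a) (hb : b.eval w = true) : w ∈ normalWorlds K b := by
  intro c hc
  have h₁ : (b, b.impl c) ∈ K :=
    hK.right_weaken (fun w hw => by simp [Fm.eval, hw]) hc
  have h₂ : (a.conj b.neg, b.impl c) ∈ K :=
    hK.right_weaken (fun w hw => by simp_all [Fm.eval]) (hK.refl _)
  have h₃ : (a, b.impl c) ∈ K := by
    refine hK.left_equiv (fun w => ?_) (hK.or h₁ h₂)
    have := hba w
    cases ha : a.eval w <;> cases hb : b.eval w <;> simp_all [Fm.eval]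
  have := hw _ h₃
  simpa [Fm.eval, hb] using this

theorem normalWorlds_nonempty (hK : IsPreferential K) {a b : Fm V} {w : V → Bool}
    (hw : w ∈ normalWorlds K a) (hb : b.eval w = true) : (normalWorlds K b).Nonempty := by
  by_contra hne
  rw [Set.not_nonempty_iff_eq_empty] at hne
  have h : ∀ c, (b, c) ∈ K := fun c => hK.mem_iff_normalWorlds.2 (by simp [hne])
  have hab : (a.conj b, Fm.fls) ∈ K :=
    hK.left_equiv (fun w => by simp [Fm.eval, Bool.and_comm]) (hK.cautious_mono (h a) (h .fls))
  have hw' := hK.mem_normalWorlds_of_entails (b := a.conj b)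
    (fun w hw => by simp_all [Fm.eval]) hw
    (by simp [Fm.eval, hb, hK.eval_of_mem_normalWorlds hw])
  simpa [Fm.eval] using hw' _ hab

end IsPreferential

namespace IsRational

variable {V : Type} {K : CRel V}

/-- If `b` entails `a` and some normal `a`-world satisfies `b`, then every normal `b`-world is a
normal `a`-world. -/
theorem mem_normalWorlds_of_entails (hK : IsRational K) {a b : Fm V}
    (hba : ∀ w, b.eval w = true → a.eval w = true) {v w : V → Bool}
    (hv : v ∈ normalWorlds K a) (hvb : b.eval v = true) (hw : w ∈ normalWorlds K b) :
    w ∈ normalWorlds K a := by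
  intro c hc
  by_contra hwc
  refine hK.2 a b c (fun h => hwc (hw c (hK.1.left_equiv (fun u => ?_) h))) (fun h => ?_) hc
  · have := hba u
    cases ha : a.eval u <;> cases hb : b.eval u <;> simp_all [Fm.eval]
  · simpa [Fm.eval, hvb] using hv _ h

/-- If some normal `b`-world satisfies `a`, then every normal `a`-world is normal for `a ∨ b`. -/
theorem mem_normalWorlds_disj (hK : IsRational K) {a b : Fm V} {v w : V → Bool}
    (hw : w ∈ normalWorlds K a) (hv : v ∈ normalWorlds K b) (hva : a.eval v = true) :
    w ∈ normalWorlds K (a.disj b) := by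
  have hwa := hK.1.eval_of_mem_normalWorlds hw
  obtain ⟨u, hu⟩ := hK.1.normalWorlds_nonempty (b := a.disj b) hw (by simp [Fm.eval, hwa])
  have ha : ∀ w, a.eval w = true → (a.disj b).eval w = true := fun w h => by simp [Fm.eval, h]
  have hb : ∀ w, b.eval w = true → (a.disj b).eval w = true := fun w h => by simp [Fm.eval, h]
  have hu' : a.eval u = true ∨ b.eval u = true := by
    simpa [Fm.eval] using hK.1.eval_of_mem_normalWorlds hu
  rcases hu' with h | h
  · exact hK.mem_normalWorlds_of_entails ha hu h hw
  · exact hK.mem_normalWorlds_of_entails ha (hK.mem_normalWorlds_of_entails hb hu h hv) hva hw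

end IsRational

/-- `w` is at least as normal as `v`: some formula true at `v` has `w` as a normal world. -/
def worldLE {V : Type} (K : CRel V) (w v : V → Bool) : Prop :=
  ∃ a : Fm V, w ∈ normalWorlds K a ∧ a.eval v = true

/-- The worlds that are normal for some formula. -/
def NormalWorld {V : Type} (K : CRel V) : Type := {w : V → Bool // ∃ a, w ∈ normalWorlds K a}

namespace IsRational

variable {V : Type} {K : CRel V}

/-- The normality preorder on worlds that are normal for some formula. -/
abbrev worldPreorder (hK : IsRational K) : Preorder (NormalWorld K) where
  le w v := worldLE K w.1 v.1
  le_refl w := by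
    obtain ⟨a, ha⟩ := w.2
    exact ⟨a, ha, hK.1.eval_of_mem_normalWorlds ha⟩
  le_trans := by
    rintro w v u ⟨a, hw, hv⟩ ⟨b, hv', hu⟩
    exact ⟨a.disj b, hK.mem_normalWorlds_disj hw hv' hv, by simp [Fm.eval, hu]⟩

theorem worldLE_total (hK : IsRational K) (w v : NormalWorld K) :
    worldLE K w.1 v.1 ∨ worldLE K v.1 w.1 := by
  obtain ⟨w, a, hw⟩ := w
  obtain ⟨v, b, hv⟩ := v
  have hwa := hK.1.eval_of_mem_normalWorlds hw
  have hvb := hK.1.eval_of_mem_normalWorlds hv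
  obtain ⟨u, hu⟩ := hK.1.normalWorlds_nonempty (b := a.disj b) hw (by simp [Fm.eval, hwa])
  have hu' : a.eval u = true ∨ b.eval u = true := by
    simpa [Fm.eval] using hK.1.eval_of_mem_normalWorlds hu
  rcases hu' with h | h
  · exact .inl ⟨a.disj b, hK.mem_normalWorlds_of_entails (fun w h => by simp [Fm.eval, h]) hu h hw,
      by simp [Fm.eval, hvb]⟩
  · exact .inr ⟨a.disj b, hK.mem_normalWorlds_of_entails (fun w h => by simp [Fm.eval, h]) hu h hv,
      by simp [Fm.eval, hwa]⟩

theorem minIn_iff_mem_normalWorlds (hK : IsRational K) (b : Fm V) (w : NormalWorld K) :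
    MinIn (fun w v : NormalWorld K => ¬ worldLE K v.1 w.1) {t | b.eval t.1 = true} w ↔
      w.1 ∈ normalWorlds K b := by
  constructor
  · rintro ⟨hwb, hmin⟩
    obtain ⟨a, ha⟩ := w.2
    obtain ⟨v, hv⟩ := hK.1.normalWorlds_nonempty ha hwb
    obtain ⟨c, hwc, hvc⟩ :=
      not_not.mp (hmin ⟨v, b, hv⟩ (hK.1.eval_of_mem_normalWorlds hv))
    exact hK.1.mem_normalWorlds_of_entails (fun w h => by simp [Fm.eval, h])
      (hK.mem_normalWorlds_disj hwc hv hvc) hwb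
  · exact fun hw => ⟨hK.1.eval_of_mem_normalWorlds hw, fun v hv h => h ⟨b, hw, hv⟩⟩

/-- The canonical ranked model of a rational relation: its states are the normal worlds. -/
def canonicalModel (hK : IsRational K) : PrefModel V where
  S := NormalWorld K
  l := Subtype.val
  lt w v := ¬ worldLE K v.1 w.1
  irrefl w h := h (hK.worldPreorder.le_refl w)
  trans w v u hwv hvu huw :=
    hvu (hK.worldPreorder.le_trans u w v huw ((hK.worldLE_total w v).resolve_right hwv))
  smooth b w hw := by
    simp only [hK.minIn_iff_mem_normalWorlds]
    obtain ⟨a, ha⟩ := w.2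
    obtain ⟨v, hv⟩ := hK.1.normalWorlds_nonempty ha hw
    by_cases hwv : worldLE K w.1 v
    · obtain ⟨c, hwc, hvc⟩ := hwv
      exact .inl (hK.1.mem_normalWorlds_of_entails (fun w h => by simp [Fm.eval, h])
        (hK.mem_normalWorlds_disj hwc hv hvc) hw)
    · exact .inr ⟨⟨v, b, hv⟩, hv, hwv⟩

theorem canonicalModel_ranked (hK : IsRational K) : hK.canonicalModel.Ranked := by
  classical
  let := hK.worldPreorder
  have : Std.Total (α := NormalWorld K) (· ≤ ·) := ⟨hK.worldLE_total⟩
  have rank_lt_iff (w v : NormalWorld K) : ¬ worldLE K v.1 w.1 ↔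
      toAntisymmetrization (· ≤ ·) w < toAntisymmetrization (· ≤ ·) v := by
    rw [toAntisymmetrization_lt_toAntisymmetrization_iff, lt_iff_le_not_ge]
    exact ⟨fun h => ⟨(hK.worldLE_total w v).resolve_right h, h⟩, fun h => h.2⟩
  exact ⟨Antisymmetrization (NormalWorld K) (· ≤ ·), inferInstance, _, rank_lt_iff⟩

theorem rel_canonicalModel (hK : IsRational K) : K = hK.canonicalModel.Rel := by
  ext ⟨a, b⟩
  rw [hK.1.mem_iff_normalWorlds]
  exact ⟨fun h w hw => h w.1 ((hK.minIn_iff_mem_normalWorlds a w).1 hw),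
    fun h w hw => h ⟨w, a, hw⟩ ((hK.minIn_iff_mem_normalWorlds a ⟨w, a, hw⟩).2 hw)⟩

end IsRational

/-- Representation theorem for rational relations: a relation is rational iff
it is defined by some ranked model; over a logically finite language, by a
finite ranked model. -/
theorem stmt11 (V : Type) :
    (∀ K : CRel V, IsRational K ↔ ∃ W : PrefModel V, W.Ranked ∧ K = W.Rel) ∧
    (Finite V → ∀ K : CRel V, IsRational K →
      ∃ W : PrefModel V, W.Ranked ∧ Finite W.S ∧ K = W.Rel) := by
  refine ⟨fun K => ⟨fun hK => ⟨_, hK.canonicalModel_ranked, hK.rel_canonicalModel⟩, ?_⟩,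
    fun hV K hK => ⟨_, hK.canonicalModel_ranked, ?_, hK.rel_canonicalModel⟩⟩
  · rintro ⟨W, hW, rfl⟩
    exact hW.isRational_rel
  · exact inferInstanceAs (Finite {w : V → Bool // ∃ a, w ∈ normalWorlds K a})
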